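/- Let 𝓕 be a filter on ℕ that contains the cofinite (Fréchet) filter and is countably generated (i.e., there is a countable family of subsets of ℕ such that 𝓕 consists exactly of the sets containing some finite intersection of members of that family together with the cofinite filter). Then for every 𝓕-basis (x_n) of a Banach space X, all of the coordinate functionals a_n : X → 𝕂 are continuous. -/

import Mathlib

open Filter Finset

open scoped Topology

/-- `x` is an `𝓕`-basis with coordinate functionals `y ↦ a y k`: the expansion `∑ b k • x k`
converges to `y` along `𝓕` exactly when `b = a y`. -/
def IsFilterBasis {𝕂 X : Type*} [RCLike 𝕂] [NormedAddCommGroup X] [NormedSpace 𝕂 X]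
    (𝓕 : Filter ℕ) (x : ℕ → X) (a : X → ℕ → 𝕂) : Prop :=
  ∀ (y : X) (b : ℕ → 𝕂), Tendsto (fun n => ∑ k ∈ range n, b k • x k) 𝓕 (𝓝 y) ↔ b = a y

namespace IsFilterBasis

variable {𝕂 X : Type*} [RCLike 𝕂] [NormedAddCommGroup X] [NormedSpace 𝕂 X]
  {𝓕 : Filter ℕ} {x : ℕ → X} {a : X → ℕ → 𝕂}

theorem tendsto (h : IsFilterBasis 𝓕 x a) (y : X) :
    Tendsto (fun n => ∑ k ∈ range n, a y k • x k) 𝓕 (𝓝 y) :=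
  (h y _).2 rfl

theorem neBot (h : IsFilterBasis 𝓕 x a) : 𝓕.NeBot := by
  refine ⟨fun hbot => ?_⟩
  subst hbot
  have h01 : (0 : ℕ → 𝕂) = 1 := ((h 0 0).1 tendsto_bot).trans ((h 0 1).1 tendsto_bot).symm
  exact zero_ne_one h01

theorem map_add (h : IsFilterBasis 𝓕 x a) (y z : X) : a (y + z) = a y + a z := by
  refine ((h _ _).1 ?_).symm
  simpa [add_smul, sum_add_distrib] using (h.tendsto y).add (h.tendsto z)

theorem map_smul (h : IsFilterBasis 𝓕 x a) (c : 𝕂) (y : X) : a (c • y) = c • a y := by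
  refine ((h _ _).1 ?_).symm
  simpa [mul_smul, smul_sum] using (h.tendsto y).const_smul c

/-- The coordinates, bundled as a linear map into scalar sequences. -/
def coordMap (h : IsFilterBasis 𝓕 x a) : X →ₗ[𝕂] ℕ → 𝕂 where
  toFun := a
  map_add' := h.map_add
  map_smul' := h.map_smul

/-- The `n`-th partial sum operator. -/
def partialSum (h : IsFilterBasis 𝓕 x a) (n : ℕ) : X →ₗ[𝕂] X where
  toFun y := ∑ k ∈ range n, a y k • x k
  map_add' y z := by simp [h.map_add, add_smul, sum_add_distrib]
  map_smul' c y := by simp [h.map_smul, mul_smul, smul_sum]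

theorem partialSum_apply (h : IsFilterBasis 𝓕 x a) (n : ℕ) (y : X) :
    h.partialSum n y = ∑ k ∈ range n, a y k • x k := rfl

theorem tendsto_partialSum (h : IsFilterBasis 𝓕 x a) (y : X) :
    Tendsto (fun n => h.partialSum n y) 𝓕 (𝓝 y) :=
  h.tendsto y

theorem eq_zero_of_sum_range_eq_zero (h : IsFilterBasis 𝓕 x a) (hF : 𝓕 ≤ atTop) {n : ℕ}
    {b : ℕ → 𝕂} (hb : ∑ k ∈ range n, b k • x k = 0) {k : ℕ} (hk : k < n) : b k = 0 := by
  have hz : a 0 = 0 := h.coordMap.map_zero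
  have key : (fun i => if i < n then b i else 0) = a 0 := by
    refine (h _ _).1 (tendsto_const_nhds.congr' ?_)
    filter_upwards [hF (eventually_ge_atTop n)] with m hm
    rw [← hb, ← sum_subset (range_mono hm)]
    · exact sum_congr rfl fun i hi => by simp [mem_range.1 hi]
    · intro i _ hi
      simp [mt mem_range.2 hi]
  simpa [hk, hz] using congrFun key k

/-- Each coefficient of a finite expansion is controlled by the norm of its sum. -/
theorem exists_norm_coeff_le (h : IsFilterBasis 𝓕 x a) (hF : 𝓕 ≤ atTop) {k n : ℕ} (hk : k < n) :
    ∃ K : ℝ, 0 ≤ K ∧ ∀ b : ℕ → 𝕂, ‖b k‖ ≤ K * ‖∑ i ∈ range n, b i • x i‖ := by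
  let T : (Fin n → 𝕂) →ₗ[𝕂] X := Fintype.linearCombination 𝕂 fun i : Fin n => x i
  have hT (b : ℕ → 𝕂) : T (fun i => b i) = ∑ i ∈ range n, b i • x i := by
    simp [T, Fintype.linearCombination_apply, Fin.sum_univ_eq_sum_range fun i => b i • x i]
  have hker : T.ker = ⊥ := by
    refine LinearMap.ker_eq_bot'.2 fun c hc => funext fun i => ?_
    let b : ℕ → 𝕂 := fun j => if hj : j < n then c ⟨j, hj⟩ else 0
    have hbc : (fun j : Fin n => b j) = c := by
      funext j
      simp [b]
    have hb : ∑ j ∈ range n, b j • x j = 0 := by rw [← hT, hbc, hc]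
    simpa [b] using h.eq_zero_of_sum_range_eq_zero hF hb i.2
  obtain ⟨K, -, hK⟩ := T.exists_antilipschitzWith hker
  refine ⟨K, K.2, fun b => ?_⟩
  calc ‖b k‖ ≤ ‖fun i : Fin n => b i‖ := norm_le_pi_norm (fun i : Fin n => b i) ⟨k, hk⟩
    _ ≤ K * ‖T fun i => b i‖ := by
      simpa using hK.le_mul_dist (fun i : Fin n => b i) 0
    _ = K * ‖∑ i ∈ range n, b i • x i‖ := by rw [hT]

/-- By Baire's theorem, on some member of a countably generated filter the partial sums are
controlled up to approximation. -/
theorem exists_approx [CompleteSpace X] [𝓕.IsCountablyGenerated] (h : IsFilterBasis 𝓕 x a) :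
    ∃ A ∈ 𝓕, ∃ C : ℝ, 0 ≤ C ∧
      ∀ z, ∃ e, (∀ n ∈ A, ‖h.partialSum n e‖ ≤ C * ‖z‖) ∧ ‖z - e‖ ≤ ‖z‖ / 2 := by
  obtain ⟨U, hU⟩ := 𝓕.exists_antitone_basis
  let E : ℕ × ℕ → Set X := fun p => {y | ∀ n ∈ U p.1, ‖h.partialSum n y‖ ≤ p.2}
  have hcover : ⋃ p, closure (E p) = Set.univ := by
    refine Set.eq_univ_of_forall fun y => Set.mem_iUnion.2 ?_
    obtain ⟨m, hm⟩ := hU.mem_iff.1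
      ((h.tendsto_partialSum y).norm.eventually_le_const (lt_add_one ‖y‖))
    obtain ⟨N, hN⟩ := exists_nat_ge (‖y‖ + 1)
    exact ⟨(m, N), subset_closure fun n hn => (hm hn).trans hN⟩
  obtain ⟨⟨m, N⟩, w, hw⟩ :=
    nonempty_interior_of_iUnion_of_closed (fun p => isClosed_closure (s := E p)) hcover
  obtain ⟨ε, hε, hball⟩ := Metric.isOpen_iff.1 isOpen_interior w hw
  have happrox : ∀ v ∈ Metric.ball w ε, ∃ e ∈ E (m, N), ‖v - e‖ < ε / 8 := fun v hv => by
    simpa [dist_eq_norm] using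
      Metric.mem_closure_iff.1 (interior_subset (hball hv)) (ε / 8) (by positivity)
  refine ⟨U m, hU.mem m, 2 * N * (2 / ε), by positivity, fun z => ?_⟩
  rcases eq_or_ne z 0 with rfl | hz
  · exact ⟨0, by simp⟩
  have hz' : 0 < ‖z‖ := norm_pos_iff.2 hz
  let t : 𝕂 := ((2 * ‖z‖ / ε : ℝ) : 𝕂)
  have ht : ‖t‖ = 2 * ‖z‖ / ε := by
    rw [RCLike.norm_ofReal, abs_of_pos (by positivity)]
  have ht0 : t ≠ 0 := norm_pos_iff.1 (ht ▸ by positivity)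
  obtain ⟨e₁, he₁, h₁⟩ := happrox (w + t⁻¹ • z) (by
    rw [mem_ball_iff_norm, add_sub_cancel_left, norm_smul, norm_inv, ht]
    field_simp
    linarith)
  obtain ⟨e₂, he₂, h₂⟩ := happrox w (Metric.mem_ball_self hε)
  refine ⟨t • (e₁ - e₂), fun n hn => ?_, ?_⟩
  · rw [_root_.map_smul, map_sub, norm_smul, ht]
    calc 2 * ‖z‖ / ε * ‖h.partialSum n e₁ - h.partialSum n e₂‖
        ≤ 2 * ‖z‖ / ε * (N + N) := by
          gcongr
          exact (norm_sub_le _ _).trans (add_le_add (he₁ n hn) (he₂ n hn))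
      _ = 2 * N * (2 / ε) * ‖z‖ := by ring
  · have hsplit : z - t • (e₁ - e₂) = t • ((w + t⁻¹ • z - e₁) - (w - e₂)) := by
      have : t • t⁻¹ • z = z := smul_inv_smul₀ ht0 z
      simp only [smul_sub, smul_add, this]
      abel
    rw [hsplit, norm_smul, ht]
    calc 2 * ‖z‖ / ε * ‖(w + t⁻¹ • z - e₁) - (w - e₂)‖
        ≤ 2 * ‖z‖ / ε * (ε / 8 + ε / 8) := by
          gcongr
          exact (norm_sub_le _ _).trans (add_le_add h₁.le h₂.le)
      _ = ‖z‖ / 2 := by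
          field_simp
          norm_num

/-- If the partial sums of `e j` are dominated on a member of `𝓕` by a summable sequence, then the
coordinates of `∑ e j` are obtained by summing those of the `e j`. -/
theorem hasSum_coord [CompleteSpace X] (h : IsFilterBasis 𝓕 x a) (hF : 𝓕 ≤ atTop)
    {A : Set ℕ} (hA : A ∈ 𝓕) {e : ℕ → X} {u : ℕ → ℝ} (hu : Summable u)
    (he : ∀ j, ∀ n ∈ A, ‖h.partialSum n (e j)‖ ≤ u j) {y : X} (hy : HasSum e y) (k : ℕ) :
    HasSum (fun j => a (e j) k) (a y k) := by
  have := h.neBot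
  have hs (k : ℕ) : Summable fun j => a (e j) k := by
    obtain ⟨n, hn, hkn⟩ := nonempty_of_mem (inter_mem hA (hF (Ioi_mem_atTop k)))
    obtain ⟨K, hK, hb⟩ := h.exists_norm_coeff_le hF hkn
    exact (hu.mul_left K).of_norm_bounded fun j =>
      (hb (a (e j))).trans (mul_le_mul_of_nonneg_left (he j n hn) hK)
  have hlim : Tendsto (fun n => ∑' j, h.partialSum n (e j)) 𝓕 (𝓝 (∑' j, e j)) :=
    tendsto_tsum_of_dominated_convergence hu (fun j => h.tendsto_partialSum (e j))
      (mem_of_superset hA fun n hn j => he j n hn)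
  have hcoord : (fun k => ∑' j, a (e j) k) = a y := by
    refine (h _ _).1 ?_
    rw [hy.tsum_eq] at hlim
    refine hlim.congr fun n => ?_
    simp only [partialSum_apply]
    rw [Summable.tsum_finsetSum fun k _ => (hs k).smul_const (x k)]
    exact sum_congr rfl fun k _ => (hs k).tsum_smul_const (x k)
  exact congrFun hcoord k ▸ (hs k).hasSum

/-- The coordinate functionals of a basis with respect to a countably generated filter finer than
`atTop` are continuous. -/
theorem continuous_coord [CompleteSpace X] [𝓕.IsCountablyGenerated] (h : IsFilterBasis 𝓕 x a)
    (hF : 𝓕 ≤ atTop) (k : ℕ) : Continuous fun y => a y k := by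
  have := h.neBot
  obtain ⟨A, hA, C, hC, happrox⟩ := h.exists_approx
  choose f hfA hf using happrox
  obtain ⟨n, hn, hkn⟩ := nonempty_of_mem (inter_mem hA (hF (Ioi_mem_atTop k)))
  obtain ⟨K, hK, hb⟩ := h.exists_norm_coeff_le hF hkn
  refine AddMonoidHomClass.continuous_of_bound ((LinearMap.proj k).comp h.coordMap)
    (K * C * 2) fun y => ?_
  let r : ℕ → X := fun j => (fun z => z - f z)^[j] y
  have hr_succ (j : ℕ) : r (j + 1) = r j - f (r j) := Function.iterate_succ_apply' _ _ _
  have hr (j : ℕ) : ‖r j‖ ≤ ‖y‖ * (1 / 2) ^ j := by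
    induction j with
    | zero => simp [r]
    | succ j ih =>
      rw [hr_succ, pow_succ]
      linarith [hf (r j)]
  have hgeom : HasSum (fun j : ℕ => ‖y‖ * (1 / 2 : ℝ) ^ j) (‖y‖ * 2) :=
    hasSum_geometric_two.mul_left _
  have hfr (j : ℕ) : f (r j) = r j - r (j + 1) := by rw [hr_succ, sub_sub_cancel]
  have hr_sum : Summable r := hgeom.summable.of_norm_bounded hr
  have hy : HasSum (fun j => f (r j)) y := by
    have hs : Summable fun j => f (r j) := by
      simpa only [hfr] using hr_sum.sub ((summable_nat_add_iff 1).2 hr_sum)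
    refine (hs.hasSum_iff_tendsto_nat).2 ?_
    simp only [hfr, sum_range_sub']
    simpa [r] using hr_sum.tendsto_atTop_zero.const_sub (r 0)
  have hbound (j m : ℕ) (hm : m ∈ A) :
      ‖h.partialSum m (f (r j))‖ ≤ C * (‖y‖ * (1 / 2) ^ j) :=
    (hfA (r j) m hm).trans (mul_le_mul_of_nonneg_left (hr j) hC)
  have hcoord := h.hasSum_coord hF hA (hgeom.mul_left C).summable hbound hy k
  have hmajor := (hgeom.mul_left C).mul_left K
  calc ‖a y k‖ ≤ K * (C * (‖y‖ * 2)) := by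
        rw [← hcoord.tsum_eq]
        exact tsum_of_norm_bounded hmajor fun j =>
          (hb _).trans (mul_le_mul_of_nonneg_left (hbound j n hn) hK)
    _ = K * C * 2 * ‖y‖ := by ring

end IsFilterBasis

/-- **Kochanek's theorem.** If `𝓕` is a filter on `ℕ` containing the cofinite (Fréchet)
filter which is countably generated (together with the cofinite filter) by a countable
family `g`, then the coordinate functionals of any `𝓕`-basis of a Banach space are
continuous. -/
theorem countably_generated_filter_basis_coord_functionals_continuous
    {𝕂 X : Type*} [RCLike 𝕂] [NormedAddCommGroup X] [NormedSpace 𝕂 X] [CompleteSpace X]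
    (𝓕 : Filter ℕ) (hFr : 𝓕 ≤ Filter.cofinite)
    (g : ℕ → Set ℕ)
    (hgen : ∀ A : Set ℕ, A ∈ 𝓕 ↔
      ∃ (s : Finset ℕ) (C : Set ℕ), Cᶜ.Finite ∧ ((⋂ i ∈ s, g i) ∩ C) ⊆ A)
    (x : ℕ → X) (a : X → ℕ → 𝕂)
    (hconv : ∀ y : X, ∀ ε : ℝ, 0 < ε →
      {n : ℕ | ‖(∑ k ∈ Finset.range n, a y k • x k) - y‖ < ε} ∈ 𝓕)
    (huniq : ∀ (y : X) (b : ℕ → 𝕂),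
      (∀ ε : ℝ, 0 < ε →
        {n : ℕ | ‖(∑ k ∈ Finset.range n, b k • x k) - y‖ < ε} ∈ 𝓕) → b = a y) :
    ∀ k : ℕ, Continuous fun y : X => a y k := by
  have hbasis : 𝓕.HasBasis (fun _ => True)
      fun p : Finset ℕ × Finset ℕ => (⋂ i ∈ p.1, g i) ∩ (p.2 : Set ℕ)ᶜ := by
    refine ⟨fun A => (hgen A).trans ⟨?_, ?_⟩⟩
    · rintro ⟨s, D, hD, hsub⟩
      exact ⟨(s, hD.toFinset), trivial, by simpa using hsub⟩
    · rintro ⟨⟨s, t⟩, -, hsub⟩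
      exact ⟨s, (t : Set ℕ)ᶜ, by simp, hsub⟩
  have : 𝓕.IsCountablyGenerated :=
    HasCountableBasis.isCountablyGenerated ⟨hbasis, Set.to_countable _⟩
  have htendsto (y : X) (b : ℕ → 𝕂) : Tendsto (fun n => ∑ k ∈ range n, b k • x k) 𝓕 (𝓝 y) ↔
      ∀ ε : ℝ, 0 < ε → {n : ℕ | ‖(∑ k ∈ range n, b k • x k) - y‖ < ε} ∈ 𝓕 := by
    simp only [Metric.tendsto_nhds, dist_eq_norm, Filter.Eventually, gt_iff_lt]
  have h : IsFilterBasis 𝓕 x a := fun y b =>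
    ⟨fun hb => huniq y b ((htendsto y b).1 hb), fun hb => hb ▸ (htendsto y _).2 (hconv y)⟩
  exact h.continuous_coord (hFr.trans Nat.cofinite_eq_atTop.le)
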